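/- arXiv:1206.3715 — 2 statements merged into one kernel-verified Lean document; each statement's English description precedes it below -/
import Mathlib

section
/- The only integer solutions (X, Y) of the Mordell equation X^2 − 2000 = Y^3 are (X, Y) = (±100, 20) and (X, Y) = (±44, −4). -/
/-- The norm of `x + y θ + z θ²`, where `θ³ + 3θ = 1`. -/
def cubicNorm (x y z : ℤ) : ℤ :=
  x ^ 3 + y ^ 3 + z ^ 3 - 6 * x ^ 2 * z + 9 * x * z ^ 2 + 3 * x * y ^ 2 + 3 * y * z ^ 2
    - 3 * x * y * z

/-- The order `ℤ[θ]` as a subring of `ℝ`. -/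
def cubicOrder (θ : ℝ) (hθ : θ ^ 3 = 1 - 3 * θ) : Subring ℝ where
  carrier := {r | ∃ x y z : ℤ, r = x + y * θ + z * θ ^ 2}
  mul_mem' := by
    rintro _ _ ⟨x, y, z, rfl⟩ ⟨x', y', z', rfl⟩
    refine ⟨x * x' + (y * z' + z * y'), x * y' + y * x' - 3 * (y * z' + z * y') + z * z',
      x * z' + y * y' + z * x' - 3 * (z * z'), ?_⟩
    push_cast
    linear_combination ((y * z' + z * y' : ℝ) + z * z' * θ) * hθ
  one_mem' := ⟨1, 0, 0, by simp⟩
  add_mem' := by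
    rintro _ _ ⟨x, y, z, rfl⟩ ⟨x', y', z', rfl⟩
    exact ⟨x + x', y + y', z + z', by push_cast; ring⟩
  zero_mem' := ⟨0, 0, 0, by simp⟩
  neg_mem' := by
    rintro _ ⟨x, y, z, rfl⟩
    exact ⟨-x, -y, -z, by push_cast; ring⟩

theorem exists_cubic_root : ∃ θ : ℝ, θ ^ 3 = 1 - 3 * θ ∧ 0.322 < θ ∧ θ < 0.323 := by
  have hc : ContinuousOn (fun t : ℝ => t ^ 3 + 3 * t) (Set.Icc 0.322 0.323) := by fun_prop
  obtain ⟨t, ⟨h₁, h₂⟩, h⟩ := intermediate_value_Ioo (by norm_num) hc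
    (show (1 : ℝ) ∈ Set.Ioo _ _ by constructor <;> norm_num)
  exact ⟨t, by simp only at h; linarith, h₁, h₂⟩

/-- The norm splits as the real embedding times a sum of squares. -/
theorem cubicNorm_eq_mul {θ : ℝ} (hθ : θ ^ 3 = 1 - 3 * θ) (x y z : ℤ) :
    (cubicNorm x y z : ℝ) = (x + y * θ + z * θ ^ 2) *
      ((x - y * θ / 2 - z * (θ ^ 2 / 2 + 3)) ^ 2 + (3 + 3 * θ ^ 2 / 4) * (y - θ * z) ^ 2) := by
  unfold cubicNorm
  push_cast
  linear_combination (3 * x * y * z - y ^ 3 - 3 * y * z ^ 2 - z ^ 3 * (θ ^ 3 + 3 * θ + 1) : ℝ) * hθ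

theorem even_of_cubicNorm_eq_zero {x y z : ℤ} (h : cubicNorm x y z = 0) :
    2 ∣ x ∧ 2 ∣ y ∧ 2 ∣ z := by
  have key : ∀ a b c : ZMod 2, a ^ 3 + b ^ 3 + c ^ 3 - 6 * a ^ 2 * c + 9 * a * c ^ 2
      + 3 * a * b ^ 2 + 3 * b * c ^ 2 - 3 * a * b * c = 0 → a = 0 ∧ b = 0 ∧ c = 0 := by decide
  have h2 := congrArg (Int.cast : ℤ → ZMod 2) h
  simp only [cubicNorm] at h2
  push_cast at h2
  obtain ⟨hx, hy, hz⟩ := key _ _ _ h2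
  exact ⟨(ZMod.intCast_zmod_eq_zero_iff_dvd x 2).mp hx,
    (ZMod.intCast_zmod_eq_zero_iff_dvd y 2).mp hy, (ZMod.intCast_zmod_eq_zero_iff_dvd z 2).mp hz⟩

theorem eq_zero_of_cubicNorm_eq_zero {x y z : ℤ} (h : cubicNorm x y z = 0) :
    x = 0 ∧ y = 0 ∧ z = 0 := by
  induction hn : x.natAbs + y.natAbs + z.natAbs using Nat.strong_induction_on
    generalizing x y z with
  | _ n ih =>
    obtain ⟨⟨a, rfl⟩, ⟨b, rfl⟩, ⟨c, rfl⟩⟩ := even_of_cubicNorm_eq_zero h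
    by_cases h0 : a.natAbs + b.natAbs + c.natAbs = 0
    · omega
    · have := ih _ (by omega) (x := a) (y := b) (z := c)
        (by unfold cubicNorm at h ⊢; linarith) rfl
      omega

theorem coeff_unique {θ : ℝ} (hθ : θ ^ 3 = 1 - 3 * θ) {x y z x' y' z' : ℤ}
    (h : (x + y * θ + z * θ ^ 2 : ℝ) = x' + y' * θ + z' * θ ^ 2) : x = x' ∧ y = y' ∧ z = z' := by
  have hN := cubicNorm_eq_mul hθ (x - x') (y - y') (z - z')
  rw [show ((x - x' : ℤ) + (y - y' : ℤ) * θ + (z - z' : ℤ) * θ ^ 2 : ℝ) = 0 by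
    push_cast; linarith, zero_mul] at hN
  obtain ⟨h₁, h₂, h₃⟩ := eq_zero_of_cubicNorm_eq_zero (Int.cast_eq_zero.mp hN)
  omega

theorem exists_root_pow_three_mul {θ : ℝ} (hθ : θ ^ 3 = 1 - 3 * θ) (m : ℕ) :
    ∃ w ∈ cubicOrder θ hθ, θ ^ (3 * m) = 1 + 3 * w := by
  have ht : θ ∈ cubicOrder θ hθ := ⟨0, 1, 0, by simp⟩
  induction m with
  | zero => exact ⟨0, zero_mem _, by simp⟩
  | succ m ih =>
    obtain ⟨w, hw, h⟩ := ih
    refine ⟨w - θ - 3 * θ * w, sub_mem (sub_mem hw ht)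
      (mul_mem (mul_mem (natCast_mem _ 3) ht) hw), ?_⟩
    rw [mul_add, pow_add, h, mul_one, hθ]
    ring

theorem exists_root_pow_pow_three {θ : ℝ} (hθ : θ ^ 3 = 1 - 3 * θ) (k : ℕ) :
    ∃ w ∈ cubicOrder θ hθ, θ ^ 3 ^ (k + 1) = 1 + 3 ^ (k + 1) * (-θ + 3 * w) := by
  have ht : θ ∈ cubicOrder θ hθ := ⟨0, 1, 0, by simp⟩
  induction k with
  | zero => exact ⟨0, zero_mem _, by simp [hθ]; ring⟩
  | succ k ih =>
    obtain ⟨w, hw, h⟩ := ih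
    have hb : -θ + 3 * w ∈ cubicOrder θ hθ :=
      add_mem (neg_mem ht) (mul_mem (natCast_mem _ 3) hw)
    refine ⟨w + 3 ^ k * (-θ + 3 * w) ^ 2 + 3 ^ (2 * k) * (-θ + 3 * w) ^ 3,
      add_mem (add_mem hw (mul_mem (pow_mem (natCast_mem _ 3) _) (pow_mem hb _)))
        (mul_mem (pow_mem (natCast_mem _ 3) _) (pow_mem hb _)), ?_⟩
    rw [pow_succ 3 (k + 1), pow_mul, h]
    ring

theorem exists_one_add_pow {θ : ℝ} (hθ : θ ^ 3 = 1 - 3 * θ) {w : ℝ} (hw : w ∈ cubicOrder θ hθ)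
    (k m : ℕ) : ∃ v ∈ cubicOrder θ hθ,
      (1 + 3 ^ (k + 1) * (-θ + 3 * w)) ^ m = 1 + 3 ^ (k + 1) * (-(m * θ) + 3 * v) := by
  have ht : θ ∈ cubicOrder θ hθ := ⟨0, 1, 0, by simp⟩
  have hb : -θ + 3 * w ∈ cubicOrder θ hθ := add_mem (neg_mem ht) (mul_mem (natCast_mem _ 3) hw)
  induction m with
  | zero => exact ⟨0, zero_mem _, by simp⟩
  | succ m ih =>
    obtain ⟨v, hv, h⟩ := ih
    have hc : -(m * θ) + 3 * v ∈ cubicOrder θ hθ :=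
      add_mem (neg_mem (mul_mem (natCast_mem _ m) ht)) (mul_mem (natCast_mem _ 3) hv)
    refine ⟨v + w + 3 ^ k * ((-(m * θ) + 3 * v) * (-θ + 3 * w)), add_mem (add_mem hv hw)
      (mul_mem (pow_mem (natCast_mem _ 3) _) (mul_mem hc hb)), ?_⟩
    rw [pow_succ, h]
    push_cast
    ring

theorem three_dvd_of_add_three_mul_eq {θ : ℝ} (hθ : θ ^ 3 = 1 - 3 * θ) {a b e c d : ℤ} {w : ℝ}
    (hw : w ∈ cubicOrder θ hθ) (h : a + b * θ + e * θ ^ 2 + 3 * w = c + d * θ) : 3 ∣ e := by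
  obtain ⟨x, y, z, rfl⟩ := hw
  obtain ⟨-, -, h₂⟩ := coeff_unique hθ (x := a + 3 * x) (y := b + 3 * y) (z := e + 3 * z)
    (x' := c) (y' := d) (z' := 0) (by push_cast; linear_combination h)
  omega

/-- A 3-adic argument: multiplying `c + dθ` by a positive power of `θ` creates a `θ²` term. -/
theorem eq_zero_of_root_pow_mul {θ : ℝ} (hθ : θ ^ 3 = 1 - 3 * θ) {c d c' d' : ℤ}
    (hc : c % 3 = 1) (hd : d % 3 = 1) {n : ℕ}
    (h : θ ^ n * (c + d * θ) = c' + d' * θ) : n = 0 := by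
  by_contra hn
  have ht : θ ∈ cubicOrder θ hθ := ⟨0, 1, 0, by simp⟩
  have hcd : (c + d * θ : ℝ) ∈ cubicOrder θ hθ := ⟨c, d, 0, by simp⟩
  obtain ⟨w, hw, hpow⟩ := exists_root_pow_three_mul hθ (n / 3)
  have h3 : θ ^ n = (1 + 3 * w) * θ ^ (n % 3) := by rw [← hpow, ← pow_add, Nat.div_add_mod]
  have hr : n % 3 = 0 ∨ n % 3 = 1 ∨ n % 3 = 2 := by omega
  rcases hr with hr | hr | hr
  · obtain ⟨k, m, hm, hkm⟩ := Nat.exists_eq_pow_mul_and_not_dvd hn 3 (by norm_num)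
    obtain _ | k := k
    · omega
    obtain ⟨u, hu, hk⟩ := exists_root_pow_pow_three hθ k
    obtain ⟨v, hv, hkm'⟩ := exists_one_add_pow hθ hu k m
    rw [hkm, pow_mul, hk, hkm'] at h
    obtain ⟨x, y, z, hxyz⟩ := mul_mem hv hcd
    obtain ⟨-, -, h₂⟩ := coeff_unique hθ (x := c + 3 ^ (k + 1) * (3 * x))
      (y := d + 3 ^ (k + 1) * (3 * y - m * c)) (z := 3 ^ (k + 1) * (3 * z - m * d))
      (x' := c') (y' := d') (z' := 0)
      (by push_cast; linear_combination h - 3 ^ (k + 1) * 3 * hxyz)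
    have hz : 3 * z - m * d = 0 := by simpa using h₂
    have hdvd : (3 : ℤ) ∣ m * d := ⟨z, by linarith⟩
    rcases Int.prime_three.dvd_or_dvd hdvd with h' | h' <;> omega
  · have := three_dvd_of_add_three_mul_eq hθ (a := 0) (b := c) (e := d) (c := c') (d := d')
      (mul_mem (mul_mem hw ht) hcd)
      (by rw [h3, hr] at h; push_cast; linear_combination h)
    omega
  · have := three_dvd_of_add_three_mul_eq hθ (a := d) (b := -3 * d) (e := c) (c := c') (d := d')
      (mul_mem (mul_mem hw (pow_mem ht 2)) hcd)
      (by rw [h3, hr] at h; push_cast; linear_combination h - d * hθ)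
    omega

theorem exists_norm_five_zpow_mul {θ : ℝ} (hθ : θ ^ 3 = 1 - 3 * θ) {x y z : ℤ}
    (h : cubicNorm x y z = 5) (n : ℤ) : ∃ x' y' z' : ℤ,
      θ ^ n * (x + y * θ + z * θ ^ 2) = x' + y' * θ + z' * θ ^ 2 ∧ cubicNorm x' y' z' = 5 := by
  have hθ0 : θ ≠ 0 := by rintro rfl; norm_num at hθ
  induction n with
  | zero => exact ⟨x, y, z, by simp, h⟩
  | succ n ih =>
    obtain ⟨a, b, c, he, hN⟩ := ih
    refine ⟨c, a - 3 * c, b, ?_, by unfold cubicNorm at hN ⊢; linarith⟩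
    rw [zpow_add_one₀ hθ0, mul_right_comm, he]
    push_cast
    linear_combination c * hθ
  | pred n ih =>
    obtain ⟨a, b, c, he, hN⟩ := ih
    refine ⟨b + 3 * a, c, a, ?_, by unfold cubicNorm at hN ⊢; linarith⟩
    rw [zpow_sub_one₀ hθ0, mul_right_comm, he, mul_inv_eq_iff_eq_mul₀ hθ0]
    push_cast
    linear_combination -a * hθ

theorem eq_of_norm_five_of_reduced {θ : ℝ} (hθ : θ ^ 3 = 1 - 3 * θ) (hl : 0.322 < θ)
    (hu : θ < 0.323) {x y z : ℤ} (h : cubicNorm x y z = 5)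
    (h1 : 1 ≤ (x + y * θ + z * θ ^ 2 : ℝ)) (h2 : (x + y * θ + z * θ ^ 2 : ℝ) < 3.11) :
    x = 1 ∧ y = 1 ∧ z = 0 ∨ x = 1 ∧ y = 0 ∧ z = 1 := by
  have hN := cubicNorm_eq_mul hθ x y z
  rw [h] at hN
  push_cast at hN
  have hsl : 0.1 < θ ^ 2 := by nlinarith
  have hsu : θ ^ 2 < 0.11 := by nlinarith
  set r : ℝ := x + y * θ + z * θ ^ 2 with hr
  set R : ℝ := x - y * θ / 2 - z * (θ ^ 2 / 2 + 3) with hR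
  set I : ℝ := y - θ * z with hI
  have hQ : R ^ 2 + (3 + 3 * θ ^ 2 / 4) * I ^ 2 ≤ 5 := by
    have : 0 ≤ R ^ 2 + (3 + 3 * θ ^ 2 / 4) * I ^ 2 := by positivity
    nlinarith
  have hI2 : 3 * I ^ 2 ≤ 5 := by nlinarith [mul_nonneg (sq_nonneg θ) (sq_nonneg I), sq_nonneg R]
  have hR2 : R ^ 2 ≤ 5 := by nlinarith [mul_nonneg (sq_nonneg θ) (sq_nonneg I), sq_nonneg I]
  obtain ⟨hIl, hIu⟩ := abs_lt.mp
    (abs_lt_of_sq_lt_sq (show I ^ 2 < 1.3 ^ 2 by linarith) (by norm_num))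
  obtain ⟨hRl, hRu⟩ := abs_lt.mp
    (abs_lt_of_sq_lt_sq (show R ^ 2 < 2.24 ^ 2 by linarith) (by norm_num))
  have hrR : r - R = 3 / 2 * (θ * I) + z * (3 * θ ^ 2 + 3) := by rw [hr, hR, hI]; ring
  have hθ0 : 0 < θ := by linarith
  have hθIu : θ * I < 0.43 := by linarith [mul_pos hθ0 (sub_pos.mpr hIu)]
  have hθIl : -0.43 < θ * I := by linarith [mul_pos hθ0 (sub_pos.mpr hIl)]
  have hzu : z < 2 := by
    by_contra hz
    have hz' : (2 : ℝ) ≤ z := by exact_mod_cast not_lt.mp hz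
    linarith [mul_nonneg (sub_nonneg.mpr hz') (sq_nonneg θ)]
  have hzl : -2 < z := by
    by_contra hz
    have hz' : (z : ℝ) ≤ -2 := by exact_mod_cast not_lt.mp hz
    linarith [mul_nonneg (sub_nonneg.mpr hz') (sq_nonneg θ)]
  have hz : z = -1 ∨ z = 0 ∨ z = 1 := by omega
  have hθz : -0.323 < θ * z ∧ θ * z < 0.323 ∧ -0.11 < z * θ ^ 2 ∧ z * θ ^ 2 < 0.11 := by
    rcases hz with hz | hz | hz <;> rw [hz] <;> push_cast <;> refine ⟨?_, ?_, ?_, ?_⟩ <;> linarith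
  have hyu : y < 2 := by
    have : (y : ℝ) < 2 := by linarith
    exact_mod_cast this
  have hyl : -2 < y := by
    have : (-2 : ℝ) < y := by linarith
    exact_mod_cast this
  have hy : y = -1 ∨ y = 0 ∨ y = 1 := by omega
  have hθy : -0.323 < y * θ ∧ y * θ < 0.323 := by
    rcases hy with hy | hy | hy <;> rw [hy] <;> push_cast <;> refine ⟨?_, ?_⟩ <;> linarith
  have hxu : x < 4 := by
    have : (x : ℝ) < 4 := by linarith
    exact_mod_cast this
  have hxl : 0 < x := by
    have : (0 : ℝ) < x := by linarith
    exact_mod_cast this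
  have hx : x = 1 ∨ x = 2 ∨ x = 3 := by omega
  unfold cubicNorm at h
  rcases hx with rfl | rfl | rfl <;> rcases hy with rfl | rfl | rfl <;>
    rcases hz with rfl | rfl | rfl <;>
    first | (norm_num; done) | (norm_num at h; done) | (push_cast at hr; linarith)

/-- Every element of norm `5` of `ℤ[θ]` is a power of `θ` times `1 + θ` or `1 - 2θ`. -/
theorem exists_zpow_of_norm_five {θ : ℝ} (hθ : θ ^ 3 = 1 - 3 * θ) (hl : 0.322 < θ)
    (hu : θ < 0.323) {x y z : ℤ} (h : cubicNorm x y z = 5) : ∃ n : ℤ,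
      (x + y * θ + z * θ ^ 2 : ℝ) = θ ^ n * (1 + θ) ∨
        (x + y * θ + z * θ ^ 2 : ℝ) = θ ^ n * (1 - 2 * θ) := by
  have hθ0 : 0 < θ := by linarith
  have hpos : 0 < (x + y * θ + z * θ ^ 2 : ℝ) := by
    have hN := cubicNorm_eq_mul hθ x y z
    rw [h] at hN
    push_cast at hN
    exact pos_of_mul_pos_left (by rw [← hN]; norm_num) (by positivity)
  obtain ⟨n, hn1, hn2⟩ := exists_mem_Ico_zpow hpos ((one_lt_inv₀ hθ0).mpr (by linarith))
  obtain ⟨a, b, c, he, hN⟩ := exists_norm_five_zpow_mul hθ h n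
  have hinv : θ⁻¹ ^ n * θ ^ n = 1 := by
    rw [← mul_zpow, inv_mul_cancel₀ hθ0.ne', one_zpow]
  have hpn : 0 < θ ^ n := zpow_pos hθ0 n
  have hθinv : θ⁻¹ < 3.11 := by
    rw [inv_lt_iff_one_lt_mul₀ hθ0]; linarith
  have hback : (x + y * θ + z * θ ^ 2 : ℝ) = θ ^ (-n) * (a + b * θ + c * θ ^ 2) := by
    rw [← he, zpow_neg, inv_mul_cancel_left₀ hpn.ne']
  rcases eq_of_norm_five_of_reduced hθ hl hu hN
    (by rw [← he]; nlinarith)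
    (by
      rw [zpow_add_one₀ (inv_ne_zero hθ0.ne')] at hn2
      rw [← he]
      nlinarith) with ⟨rfl, rfl, rfl⟩ | ⟨rfl, rfl, rfl⟩
  · exact ⟨-n, Or.inl (by rw [hback]; push_cast; ring)⟩
  · refine ⟨-n - 1, Or.inr ?_⟩
    rw [hback, zpow_sub_one₀ hθ0.ne', mul_assoc]
    congr 1
    rw [eq_inv_mul_iff_mul_eq₀ hθ0.ne']
    push_cast
    linear_combination hθ

theorem eq_of_zpow_mul_eq {θ : ℝ} (hθ : θ ^ 3 = 1 - 3 * θ) {c d c' d' : ℤ}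
    (hc : c % 3 = 1) (hd : d % 3 = 1) (hc' : c' % 3 = 1) (hd' : d' % 3 = 1) {n : ℤ}
    (h : (c + d * θ : ℝ) = θ ^ n * (c' + d' * θ)) : c = c' ∧ d = d' := by
  have hθ0 : θ ≠ 0 := by rintro rfl; norm_num at hθ
  have hn : n = 0 := by
    obtain ⟨m, rfl | rfl⟩ := n.eq_nat_or_neg
    · rw [zpow_natCast] at h
      exact_mod_cast eq_zero_of_root_pow_mul hθ hc' hd' h.symm
    · rw [zpow_neg, zpow_natCast, eq_inv_mul_iff_mul_eq₀ (pow_ne_zero m hθ0)] at h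
      simpa using eq_zero_of_root_pow_mul hθ hc hd h
  rw [hn, zpow_zero, one_mul] at h
  obtain ⟨h₁, h₂, -⟩ := coeff_unique hθ (x := c) (y := d) (z := 0) (x' := c') (y' := d') (z' := 0)
    (by simpa using h)
  exact ⟨h₁, h₂⟩

theorem thue_norm_five {c d : ℤ} (h : c ^ 3 + 3 * c * d ^ 2 + d ^ 3 = 5) :
    c = 1 ∧ d = 1 ∨ c = 1 ∧ d = -2 := by
  obtain ⟨θ, hθ, hl, hu⟩ := exists_cubic_root
  have hmod : c % 3 = 1 ∧ d % 3 = 1 := by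
    have key : ∀ a b : ZMod 9, a ^ 3 + 3 * a * b ^ 2 + b ^ 3 = 5 →
        a.val % 3 = 1 ∧ b.val % 3 = 1 := by decide
    have h9 := congrArg (Int.cast : ℤ → ZMod 9) h
    push_cast at h9
    obtain ⟨hc, hd⟩ := key _ _ h9
    have hc' := ZMod.val_intCast (n := 9) c
    have hd' := ZMod.val_intCast (n := 9) d
    push_cast at hc' hd'
    omega
  obtain ⟨n, hn | hn⟩ := exists_zpow_of_norm_five hθ hl hu (x := c) (y := d) (z := 0)
    (by unfold cubicNorm; linarith)
  · exact Or.inl (eq_of_zpow_mul_eq hθ hmod.1 hmod.2 (by norm_num) (by norm_num)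
      (n := n) (by push_cast; linear_combination hn))
  · exact Or.inr (eq_of_zpow_mul_eq hθ hmod.1 hmod.2 (by norm_num) (by norm_num)
      (n := n) (by push_cast; linear_combination hn))

/-- The ring of integers `ℤ[φ]` of `ℚ(√5)`, with `φ² = 1 + φ`. -/
abbrev GoldenInt := QuadraticAlgebra ℤ 1 1

namespace GoldenInt

open QuadraticAlgebra

/-- The golden ratio. -/
def phi : GoldenInt := ⟨0, 1⟩

theorem norm_eq (z : GoldenInt) : norm z = z.re ^ 2 + z.re * z.im - z.im ^ 2 := by
  rw [norm_def]; ring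

theorem norm_ne_zero {z : GoldenInt} (hz : z ≠ 0) : norm z ≠ 0 := by
  intro h
  rw [norm_eq] at h
  by_cases hb : z.im = 0
  · exact hz (QuadraticAlgebra.ext (by simpa [hb] using h) hb)
  · have hb' : (z.im : ℚ) ≠ 0 := by exact_mod_cast hb
    have hsq : IsSquare ((5 : ℕ) : ℚ) := by
      refine ⟨(2 * z.re + z.im) / z.im, ?_⟩
      have h' : (z.re ^ 2 + z.re * z.im - z.im ^ 2 : ℚ) = 0 := by exact_mod_cast h
      field_simp
      push_cast
      linear_combination -4 * h'
    rw [Rat.isSquare_natCast_iff] at hsq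
    obtain ⟨r, hr⟩ := hsq
    have : r ≤ 2 := by nlinarith
    interval_cases r <;> omega

/-- Division by rounding the coordinates of the quotient. -/
def quot (x y : GoldenInt) : GoldenInt :=
  ⟨round ((x * star y).re / norm y : ℚ), round ((x * star y).im / norm y : ℚ)⟩

theorem two_mul_abs_sub_mul_round_le (s : ℤ) {n : ℤ} (hn : n ≠ 0) :
    2 * |s - n * round (s / n : ℚ)| ≤ |n| := by
  have hn' : (n : ℚ) ≠ 0 := by exact_mod_cast hn
  have h := abs_sub_round (s / n : ℚ)
  have h2 : |(n : ℚ)| * |(s / n : ℚ) - round (s / n : ℚ)| ≤ |(n : ℚ)| * (1 / 2) :=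
    mul_le_mul_of_nonneg_left h (abs_nonneg _)
  rw [← abs_mul, mul_sub, mul_div_cancel₀ _ hn'] at h2
  have h3 : (2 * |s - n * round (s / n : ℚ)| : ℚ) ≤ |n| := by
    push_cast
    linarith
  exact_mod_cast h3

theorem abs_norm_sub_mul_quot_lt (x : GoldenInt) {y : GoldenInt} (hy : y ≠ 0) :
    |norm (x - y * quot x y)| < |norm y| := by
  have hn := norm_ne_zero hy
  set n := norm y with hnd
  set s := x * star y with hs
  have h1 := two_mul_abs_sub_mul_round_le s.re hn
  have h2 := two_mul_abs_sub_mul_round_le s.im hn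
  set e₁ := s.re - n * (quot x y).re with he₁
  set e₂ := s.im - n * (quot x y).im with he₂
  have key : norm (x - y * quot x y) * n = e₁ ^ 2 + e₁ * e₂ - e₂ ^ 2 := by
    rw [hnd, ← norm_star y, ← map_mul, norm_eq, he₁, he₂, hs, hnd, norm_eq]
    simp
    ring
  have hpos : 0 < |n| := abs_pos.mpr hn
  have ha : 2 * |e₁| ≤ |n| := h1
  have hb : 2 * |e₂| ≤ |n| := h2
  have hlt : |norm (x - y * quot x y)| * |n| < |n| * |n| := by
    rw [← abs_mul, key]
    have h11 : 4 * |e₁| ^ 2 ≤ |n| ^ 2 := by nlinarith [abs_nonneg e₁]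
    have h22 : 4 * |e₂| ^ 2 ≤ |n| ^ 2 := by nlinarith [abs_nonneg e₂]
    rw [sq_abs] at h11 h22
    have hnn : 0 < |n| ^ 2 := by positivity
    rw [abs_lt]
    constructor <;> nlinarith [sq_nonneg (e₁ + e₂), sq_nonneg (e₁ - e₂)]
  exact lt_of_mul_lt_mul_right hlt hpos.le

noncomputable instance : EuclideanDomain GoldenInt where
  __ := (inferInstance : CommRing GoldenInt)
  __ := (inferInstance : Nontrivial GoldenInt)
  quotient := quot
  remainder x y := x - y * quot x y
  quotient_zero x := by simp [quot, QuadraticAlgebra.ext_iff]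
  quotient_mul_add_remainder_eq x y := by ring
  r := _
  r_wellFounded := (measure (Int.natAbs ∘ norm)).wf
  remainder_lt x y hy := by
    have h := abs_norm_sub_mul_quot_lt x hy
    rwa [Int.abs_eq_natAbs, Int.abs_eq_natAbs, Int.ofNat_lt] at h
  mul_left_not_lt x y hy := by
    change ¬ (norm (x * y)).natAbs < (norm x).natAbs
    rw [map_mul, Int.natAbs_mul, not_lt]
    exact Nat.le_mul_of_pos_right _ (Int.natAbs_pos.mpr (norm_ne_zero hy))

/-- Being a cube up to a factor `1`, `φ` or `φ⁻¹`. -/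
def IsUnitMulCube (p : GoldenInt) : Prop :=
  ∃ a, p = a ^ 3 ∨ p = phi * a ^ 3 ∨ p = (phi - 1) * a ^ 3

theorem phi_sq : phi ^ 2 = phi + 1 := by
  ext <;> simp [phi, sq]

theorem IsUnitMulCube.phi_mul {p : GoldenInt} (h : IsUnitMulCube p) : IsUnitMulCube (phi * p) := by
  obtain ⟨a, rfl | rfl | rfl⟩ := h
  · exact ⟨a, by simp⟩
  · exact ⟨phi * a, .inr (.inr (by linear_combination (-phi ^ 2 * a ^ 3) * phi_sq))⟩
  · exact ⟨a, .inl (by linear_combination a ^ 3 * phi_sq)⟩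

theorem IsUnitMulCube.phi_sub_one_mul {p : GoldenInt} (h : IsUnitMulCube p) :
    IsUnitMulCube ((phi - 1) * p) := by
  obtain ⟨a, rfl | rfl | rfl⟩ := h
  · exact ⟨a, by simp⟩
  · exact ⟨a, .inl (by linear_combination a ^ 3 * phi_sq)⟩
  · exact ⟨(phi - 1) * a, .inr (.inl (by
      linear_combination (-(phi - 1) ^ 2 * a ^ 3) * phi_sq))⟩

theorem isUnitMulCube_of_norm {a b : ℤ}
    (h : a ^ 2 + a * b - b ^ 2 = 1 ∨ a ^ 2 + a * b - b ^ 2 = -1) : IsUnitMulCube ⟨a, b⟩ := by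
  induction hn : a.natAbs + b.natAbs using Nat.strong_induction_on generalizing a b with
  | _ n ih =>
    have hdown : (⟨a, b⟩ : GoldenInt) = phi * ⟨b - a, a⟩ := by ext <;> simp [phi]
    have hup : (⟨a, b⟩ : GoldenInt) = (phi - 1) * ⟨b, a + b⟩ := by ext <;> simp [phi]
    rcases eq_or_ne b 0 with rfl | hb
    · have ha : a = 1 ∨ a = -1 := by
        rw [← sq_eq_one_iff]
        rcases h with h | h <;> nlinarith [sq_nonneg a]
      rcases ha with rfl | rfl
      · exact ⟨1, .inl (by ext <;> simp)⟩
      · exact ⟨-1, .inl (by rw [Odd.neg_pow (by decide), one_pow]; ext <;> simp)⟩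
    rcases eq_or_ne a 0 with rfl | ha
    · have hb : b = 1 ∨ b = -1 := by
        rw [← sq_eq_one_iff]
        rcases h with h | h <;> nlinarith [sq_nonneg b]
      rcases hb with rfl | rfl
      · exact ⟨1, .inr (.inl (by ext <;> simp [phi]))⟩
      · exact ⟨-1, .inr (.inl (by rw [Odd.neg_pow (by decide), one_pow]; ext <;> simp [phi]))⟩
    rcases lt_or_gt_of_ne ha with ha | ha <;> rcases lt_or_gt_of_ne hb with hb | hb
    · have : b ≤ a := by rcases h with h | h <;> nlinarith
      rw [hdown]
      exact (ih _ (by omega) (by rcases h with h | h <;> [right; left] <;> linarith) rfl).phi_mul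
    · have : a + b ≤ 0 := by rcases h with h | h <;> nlinarith
      rw [hup]
      exact (ih _ (by omega)
        (by rcases h with h | h <;> [right; left] <;> linarith) rfl).phi_sub_one_mul
    · have : 0 ≤ a + b := by rcases h with h | h <;> nlinarith
      rw [hup]
      exact (ih _ (by omega)
        (by rcases h with h | h <;> [right; left] <;> linarith) rfl).phi_sub_one_mul
    · have : a ≤ b := by rcases h with h | h <;> nlinarith
      rw [hdown]
      exact (ih _ (by omega) (by rcases h with h | h <;> [right; left] <;> linarith) rfl).phi_mul

theorem isUnitMulCube_of_mul_eq_cube {p q : GoldenInt} {r D : ℤ} (hr : p * q = (r : GoldenInt) ^ 3)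
    (hD : (p - q) ^ 2 = (D : GoldenInt)) (hco : IsCoprime D r) : IsUnitMulCube p := by
  have hpq : IsCoprime p q := by
    obtain ⟨u, v, huv⟩ := hco.pow_right (n := 3)
    refine ⟨u * (p - 2 * q) + v * q, u * q, ?_⟩
    have huv' : (u * D + v * r ^ 3 : GoldenInt) = 1 := by exact_mod_cast huv
    rw [← huv', ← hr, ← hD]
    ring
  obtain ⟨a, u, hu⟩ := exists_associated_pow_of_mul_eq_pow' hpq hr
  have hunit := QuadraticAlgebra.isUnit_iff_norm_isUnit.mp u.isUnit
  rw [Int.isUnit_iff, norm_eq] at hunit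
  obtain ⟨b, hb⟩ := isUnitMulCube_of_norm hunit
  refine ⟨a * b, ?_⟩
  rw [QuadraticAlgebra.mk_eta] at hb
  rcases hb with hb | hb | hb
  · exact .inl (by rw [← hu, hb]; ring)
  · exact .inr (.inl (by rw [← hu, hb]; ring))
  · exact .inr (.inr (by rw [← hu, hb]; ring))

/-- The coordinates of `⟨x, y⟩` when it is a cube up to a factor `1`, `φ` or `φ⁻¹`. -/
theorem IsUnitMulCube.exists_coords {x y : ℤ} (h : IsUnitMulCube ⟨x, y⟩) :
    ∃ c d P Q : ℤ, P = c ^ 3 + 3 * c * d ^ 2 + d ^ 3 ∧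
      Q = 3 * c ^ 2 * d + 3 * c * d ^ 2 + 2 * d ^ 3 ∧ Even Q ∧
      (x = P ∧ y = Q ∨ x = Q ∧ y = P + Q ∨ x = Q - P ∧ y = P) := by
  obtain ⟨⟨c, d⟩, h⟩ := h
  have hcube : (⟨c, d⟩ : GoldenInt) ^ 3 = ⟨c ^ 3 + 3 * c * d ^ 2 + d ^ 3,
      3 * c ^ 2 * d + 3 * c * d ^ 2 + 2 * d ^ 3⟩ := by
    rw [pow_succ, sq]
    ext <;> simp <;> ring
  rw [hcube] at h
  refine ⟨c, d, _, _, rfl, rfl, ?_, ?_⟩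
  · have h2 : Even (c * d * (c + d)) := by
      simp only [Int.even_mul, Int.even_add]; tauto
    rw [show 3 * c ^ 2 * d + 3 * c * d ^ 2 + 2 * d ^ 3 = 3 * (c * d * (c + d)) + 2 * d ^ 3 by ring]
    exact (h2.mul_left 3).add (even_two_mul _)
  · simp only [QuadraticAlgebra.ext_iff, phi, re_mul, im_mul, re_sub, im_sub, re_one, im_one] at h
    rcases h with ⟨h₁, h₂⟩ | ⟨h₁, h₂⟩ | ⟨h₁, h₂⟩
    · exact .inl ⟨h₁, h₂⟩
    · exact .inr (.inl ⟨by linarith, by linarith⟩)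
    · exact .inr (.inr ⟨by linarith, by linarith⟩)

/-- If the product of two elements of `ℤ[φ]` is an integer cube coprime to the square of their
difference, then the first is a cube up to a factor `1`, `φ` or `φ⁻¹`. -/
theorem exists_coords_of_mul_eq_cube {x y x' y' : ℤ} (r D : ℤ) (hre : x * x' + y * y' = r ^ 3)
    (him : x * y' + y * x' + y * y' = 0) (hDre : (x - x') ^ 2 + (y - y') ^ 2 = D)
    (hDim : 2 * (x - x') * (y - y') + (y - y') ^ 2 = 0) (hco : IsCoprime D r) :
    ∃ c d P Q : ℤ, P = c ^ 3 + 3 * c * d ^ 2 + d ^ 3 ∧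
      Q = 3 * c ^ 2 * d + 3 * c * d ^ 2 + 2 * d ^ 3 ∧ Even Q ∧
      (x = P ∧ y = Q ∨ x = Q ∧ y = P + Q ∨ x = Q - P ∧ y = P) := by
  refine (isUnitMulCube_of_mul_eq_cube (p := ⟨x, y⟩) (q := ⟨x', y'⟩) ?_ ?_ hco).exists_coords
  · rw [← Int.cast_pow, ← hre]
    ext
    · simp only [re_mul, re_intCast, one_mul, Int.cast_id]
    · simp only [im_mul, im_intCast, one_mul, him]
  · rw [← hDre, sq]
    ext
    · simp only [re_mul, re_sub, im_sub, re_intCast, Int.cast_id]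
      ring
    · simp only [im_mul, re_sub, im_sub, im_intCast]
      linarith

end GoldenInt

open GoldenInt

theorem isCoprime_two_of_odd {n : ℤ} (hn : Odd n) : IsCoprime 2 n :=
  (Prime.coprime_iff_not_dvd Int.prime_two).mpr (by rwa [← even_iff_two_dvd, Int.not_even_iff_odd])

theorem isCoprime_five_of_not_dvd {n : ℤ} (hn : ¬ 5 ∣ n) : IsCoprime 5 n :=
  (Prime.coprime_iff_not_dvd (by norm_num)).mpr hn

theorem five_dvd_of_odd {X Y : ℤ} (heq : X ^ 2 - 2000 = Y ^ 3) (hX : Odd X) : 5 ∣ Y := by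
  by_contra h5
  have hY : Odd Y := by
    rw [← Int.odd_pow' (n := 3) (by norm_num), ← heq]
    exact hX.pow.sub_even (by decide)
  obtain ⟨c, d, P, Q, hP, hQ, hev, h⟩ := exists_coords_of_mul_eq_cube (x := X - 20) (y := 40)
    (x' := X + 20) (y' := -40) Y (2 ^ 6 * 5 ^ 3) (by linarith) (by ring) (by ring) (by ring)
    ((isCoprime_two_of_odd hY).pow_left.mul_left (isCoprime_five_of_not_dvd h5).pow_left)
  obtain ⟨k, hk⟩ := hX
  obtain ⟨m, hm⟩ := hev
  rcases h with ⟨h₁, h₂⟩ | ⟨h₁, h₂⟩ | ⟨h₁, h₂⟩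
  · have hd : 0 < d := by
      by_contra hd
      nlinarith [mul_nonneg (neg_nonneg.mpr (not_lt.mp hd)) (sq_nonneg (2 * c + d)),
        mul_nonneg (neg_nonneg.mpr (not_lt.mp hd)) (sq_nonneg d)]
    have hd4 : d < 4 := by
      by_contra hd4
      nlinarith [mul_nonneg hd.le (sq_nonneg (2 * c + d)), mul_nonneg hd.le (sq_nonneg d)]
    interval_cases d
    · omega
    · have hc : (c + 1) ^ 2 = 5 := by linarith
      have : c + 1 < 3 := by nlinarith
      have : -3 < c + 1 := by nlinarith
      generalize c + 1 = e at *
      interval_cases e <;> omega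
    · omega
  · omega
  · omega

theorem not_odd_of_five_mul_sq_sub_eq {x y : ℤ} (heq : 5 * x ^ 2 - 16 = y ^ 3) : ¬ Odd x := by
  intro hx
  have hy : Odd y := by
    rw [← Int.odd_pow' (n := 3) (by norm_num), ← heq]
    exact ((show Odd (5 : ℤ) by decide).mul hx.pow).sub_even (by decide)
  obtain ⟨c, d, P, Q, hP, hQ, hev, h⟩ := exists_coords_of_mul_eq_cube (x := 4 - x) (y := 2 * x)
    (x' := -4 - x) (y' := 2 * x) y (2 ^ 6) (by linarith) (by ring) (by ring) (by ring)
    (isCoprime_two_of_odd hy).pow_left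
  obtain ⟨k, hk⟩ := hx
  obtain ⟨m, hm⟩ := hev
  rcases h with ⟨h₁, h₂⟩ | ⟨h₁, h₂⟩ | ⟨h₁, h₂⟩
  · have ha : (2 * c + d) * ((2 * c + d) ^ 2 + 15 * d ^ 2) = 32 := by linarith
    generalize 2 * c + d = a at ha
    have ha0 : 0 < a := by
      by_contra ha0
      nlinarith [mul_nonneg (neg_nonneg.mpr (not_lt.mp ha0)) (sq_nonneg a),
        mul_nonneg (neg_nonneg.mpr (not_lt.mp ha0)) (sq_nonneg d)]
    have ha4 : a < 4 := by
      by_contra ha4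
      nlinarith [mul_nonneg ha0.le (sq_nonneg a), mul_nonneg ha0.le (sq_nonneg d)]
    interval_cases a <;> omega
  · omega
  · omega

theorem eq_of_sq_sub_eq {x y : ℤ} (heq : x ^ 2 - 125 = 4 * y ^ 3) (h5 : ¬ 5 ∣ y) :
    x = 11 ∨ x = -11 ∨ x = 25 ∨ x = -25 := by
  obtain ⟨s, rfl⟩ : Odd x := by
    rw [← Int.odd_pow' (n := 2) (by norm_num), show x ^ 2 = 2 * (2 * y ^ 3 + 62) + 1 by linarith]
    exact odd_two_mul_add_one _
  obtain ⟨c, d, P, Q, hP, hQ, hev, h⟩ := exists_coords_of_mul_eq_cube (x := s - 2) (y := 5)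
    (x' := s + 3) (y' := -5) y (5 ^ 3) (by linarith) (by ring) (by ring) (by ring)
    (isCoprime_five_of_not_dvd h5).pow_left
  obtain ⟨m, hm⟩ := hev
  rcases h with ⟨h₁, h₂⟩ | ⟨h₁, h₂⟩ | ⟨h₁, h₂⟩
  · omega
  · rcases thue_norm_five (c := c + d) (d := -d) (by linarith) with ⟨hc, hd⟩ | ⟨hc, hd⟩
    · obtain rfl : d = -1 := by omega
      obtain rfl : c = 2 := by omega
      omega
    · obtain rfl : d = 2 := by omega
      obtain rfl : c = -1 := by omega
      omega
  · rcases thue_norm_five (h₂.trans hP).symm with ⟨rfl, rfl⟩ | ⟨rfl, rfl⟩ <;> omega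

theorem eq_of_five_mul_sq_sub_eq {t w : ℤ} (heq : 5 * t ^ 2 - 1 = 4 * w ^ 3) :
    t = 1 ∨ t = -1 := by
  obtain ⟨s, rfl⟩ : Odd t := by
    rw [← Int.odd_pow' (n := 2) (by norm_num),
      show t ^ 2 = 2 * (2 * w ^ 3 - 2 * t ^ 2) + 1 by linarith]
    exact odd_two_mul_add_one _
  obtain ⟨c, d, P, Q, hP, hQ, hev, h⟩ := exists_coords_of_mul_eq_cube (x := -s) (y := 2 * s + 1)
    (x' := -s - 1) (y' := 2 * s + 1) w 1 (by linarith) (by ring) (by ring) (by ring)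
    isCoprime_one_left
  obtain ⟨m, hm⟩ := hev
  rcases h with ⟨h₁, h₂⟩ | ⟨h₁, h₂⟩ | ⟨h₁, h₂⟩
  · omega
  · rcases thue_norm_five (c := c + 3 * d) (d := -2 * c - d) (by linarith) with
      ⟨hc, hd⟩ | ⟨hc, hd⟩
    · omega
    · obtain rfl : d = 0 := by omega
      obtain rfl : c = 1 := by omega
      omega
  · rcases thue_norm_five (c := 2 * d - c) (d := 2 * c + d) (by linarith) with
      ⟨hc, hd⟩ | ⟨hc, hd⟩
    · omega
    · obtain rfl : d = 0 := by omega
      obtain rfl : c = -1 := by omega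
      omega

theorem twenty_five_dvd_of_five_dvd {x y k m : ℤ} (heq : x ^ 2 - 125 * k = m * y ^ 3) (h5 : 5 ∣ y) :
    25 ∣ x := by
  obtain ⟨z, rfl⟩ := h5
  have h5x : 5 ∣ x := Int.Prime.dvd_pow' (k := 2) (by norm_num)
    ⟨25 * k + 25 * m * z ^ 3, by push_cast; linarith⟩
  obtain ⟨u, rfl⟩ := h5x
  obtain ⟨v, rfl⟩ : 5 ∣ u := Int.Prime.dvd_pow' (k := 2) (by norm_num)
    ⟨k + m * z ^ 3, by push_cast; linarith⟩
  exact ⟨v, by ring⟩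

theorem eq_of_cube_eq {a b : ℤ} (h : a ^ 3 = b ^ 3) : a = b :=
  (Odd.strictMono_pow (show Odd 3 by decide)).injective h

/-- The only integer solutions of the Mordell equation `X^2 - 2000 = Y^3` are
`(±100, 20)` and `(±44, -4)`. -/
theorem mordell_two_thousand (X Y : ℤ) (heq : X ^ 2 - 2000 = Y ^ 3) :
    ((X = 100 ∨ X = -100) ∧ Y = 20) ∨ ((X = 44 ∨ X = -44) ∧ Y = -4) := by
  rcases Int.even_or_odd X with hX | hX
  · have hXY : ∃ x y, X = 4 * x ∧ Y = 4 * y := by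
      obtain ⟨x, rfl⟩ := hX.two_dvd
      obtain ⟨y, rfl⟩ : 2 ∣ Y := Int.prime_two.dvd_of_dvd_pow (n := 3)
        ⟨2 * x ^ 2 - 1000, by linarith⟩
      obtain ⟨u, rfl⟩ : 2 ∣ x := Int.prime_two.dvd_of_dvd_pow (n := 2)
        ⟨y ^ 3 + 250, by linarith⟩
      obtain ⟨v, rfl⟩ : 2 ∣ y := Int.prime_two.dvd_of_dvd_pow (n := 3)
        ⟨u ^ 2 - 125, by linarith⟩
      exact ⟨u, v, by ring, by ring⟩
    obtain ⟨x, y, rfl, rfl⟩ := hXY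
    have h : x ^ 2 - 125 = 4 * y ^ 3 := by linarith
    have hx : x = 11 ∨ x = -11 ∨ x = 25 ∨ x = -25 := by
      by_cases h5 : 5 ∣ y
      · obtain ⟨t, rfl⟩ := twenty_five_dvd_of_five_dvd (x := x) (k := 1) (m := 4) (by linarith) h5
        obtain ⟨w, rfl⟩ := h5
        rcases eq_of_five_mul_sq_sub_eq (t := t) (w := w) (by linarith) with rfl | rfl <;> simp
      · exact eq_of_sq_sub_eq h h5
    rcases hx with rfl | rfl | rfl | rfl
    · have := eq_of_cube_eq (a := y) (b := -1) (by linarith); omega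
    · have := eq_of_cube_eq (a := y) (b := -1) (by linarith); omega
    · have := eq_of_cube_eq (a := y) (b := 5) (by linarith); omega
    · have := eq_of_cube_eq (a := y) (b := 5) (by linarith); omega
  · have h5 := five_dvd_of_odd heq hX
    obtain ⟨x, rfl⟩ := twenty_five_dvd_of_five_dvd (x := X) (k := 16) (m := 1) (by linarith) h5
    obtain ⟨y, rfl⟩ := h5
    exact absurd (Int.Odd.of_mul_right hX)
      (not_odd_of_five_mul_sq_sub_eq (x := x) (y := y) (by linarith))
end

section
/- If p is an odd prime, q is a prime, and a ≥ 1, b ≥ 2 are integers with p^(2a) + 16 = q^b, then (p, a, q, b) = (3, 1, 5, 2). -/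
/-- For odd `n`, every unit of the Gaussian integers is an `n`-th power. -/
theorem GaussianInt.exists_pow_eq_of_isUnit {e : GaussianInt} (he : IsUnit e) {n : ℕ}
    (hn : Odd n) : ∃ d : GaussianInt, d ^ n = e := by
  have hnorm : e.re ^ 2 + e.im ^ 2 = 1 := by
    have h := (Zsqrtd.norm_eq_one_iff' (by norm_num) e).2 he
    rw [Zsqrtd.norm_def] at h
    linarith
  have hsq : e ^ 2 = 1 ∨ e ^ 2 = -1 := by
    by_cases h0 : e.im = 0
    · left
      rw [h0] at hnorm
      ext <;> simp [pow_two, h0]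
      nlinarith
    · right
      have h1 : 1 ≤ e.im ^ 2 := by
        have := sq_nonneg e.im
        have : e.im ^ 2 ≠ 0 := pow_ne_zero 2 h0
        omega
      have h2 : e.re = 0 := by nlinarith [sq_nonneg e.re]
      rw [h2] at hnorm
      ext <;> simp [pow_two, h2]
      nlinarith
  have hfour : e ^ 4 = 1 := by
    rw [show 4 = 2 * 2 from rfl, pow_mul]
    rcases hsq with h | h <;> rw [h] <;> norm_num
  obtain ⟨m, rfl⟩ := hn
  refine ⟨e ^ (2 * m + 1), ?_⟩
  rw [← pow_mul, show (2 * m + 1) * (2 * m + 1) = 4 * (m * m + m) + 1 by ring, pow_succ, pow_mul,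
    hfour, one_pow, one_mul]

/-- If `x ^ 2 + 16` is an `n`-th power with `x` and `n` odd, then `x + 4i` is an `n`-th power. -/
theorem GaussianInt.exists_pow_eq_of_sq_add_sixteen {x y : ℤ} {n : ℕ} (hx : Odd x) (hn : Odd n)
    (h : x ^ 2 + 16 = y ^ n) : ∃ w : GaussianInt, w ^ n = ⟨x, 4⟩ := by
  have hcop : IsCoprime (⟨x, 4⟩ : GaussianInt) ⟨x, -4⟩ := by
    have hodd : IsCoprime (x ^ 2 + 16) 8 := by
      have h2 : IsCoprime (x ^ 2 + 16) 2 := by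
        rw [Int.isCoprime_iff_gcd_eq_one, Int.gcd_comm, ← Int.isCoprime_iff_gcd_eq_one]
        rw [Prime.coprime_iff_not_dvd Int.prime_two, ← even_iff_two_dvd, Int.not_even_iff_odd]
        exact (hx.pow).add_even (by decide)
      simpa using h2.pow_right (n := 3)
    obtain ⟨s, t, hst⟩ := hodd
    refine ⟨⟨s * x, -4 * s - t⟩, ⟨0, t⟩, ?_⟩
    ext <;> simp <;> linarith
  have hmul : (⟨x, 4⟩ : GaussianInt) * ⟨x, -4⟩ = (y : GaussianInt) ^ n := by
    rw [← Int.cast_pow, ← h]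
    ext
    · rw [Zsqrtd.re_intCast]
      simp
      ring
    · rw [Zsqrtd.im_intCast]
      simp
      ring
  obtain ⟨d, u, hu⟩ := exists_associated_pow_of_mul_eq_pow' hcop hmul
  obtain ⟨e, he⟩ := GaussianInt.exists_pow_eq_of_isUnit u.isUnit hn
  exact ⟨d * e, by rw [mul_pow, he, hu]⟩

/-- Odd powers of a Gaussian integer modulo high powers of its real part. -/
theorem GaussianInt.pow_odd_modEq_re (w : GaussianInt) (m : ℕ) :
    ∃ s t : ℤ, (w ^ (2 * m + 1)).re =
        w.re * ((2 * m + 1) * ((-1) ^ m * w.im ^ (2 * m)) + w.re ^ 2 * s) ∧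
      (w ^ (2 * m + 1)).im = (-1) ^ m * w.im ^ (2 * m) * w.im + w.re ^ 2 * t := by
  induction m with
  | zero => exact ⟨0, 0, by simp⟩
  | succ m ih =>
    obtain ⟨s, t, hre, him⟩ := ih
    set c := (-1) ^ m * w.im ^ (2 * m) with hc
    have hc' : (-1) ^ (m + 1) * w.im ^ (2 * (m + 1)) = -c * w.im ^ 2 := by rw [hc]; ring
    refine ⟨(2 * m + 1) * c + w.re ^ 2 * s - w.im ^ 2 * s - 2 * w.im * t,
      c * w.im + w.re ^ 2 * t - w.im ^ 2 * t +
        2 * w.im * ((2 * m + 1) * c + w.re ^ 2 * s), ?_, ?_⟩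
    · rw [show 2 * (m + 1) + 1 = (2 * m + 1) + 2 by ring, pow_add, hc', Zsqrtd.re_mul, hre, him]
      simp only [pow_two w, Zsqrtd.re_mul, Zsqrtd.im_mul]
      push_cast
      ring
    · rw [show 2 * (m + 1) + 1 = (2 * m + 1) + 2 by ring, pow_add, hc', Zsqrtd.im_mul, hre, him]
      simp only [pow_two w, Zsqrtd.re_mul, Zsqrtd.im_mul]
      ring

/-- Odd powers of a Gaussian integer modulo high powers of its imaginary part. -/
theorem GaussianInt.pow_odd_modEq_im (w : GaussianInt) (m : ℕ) :
    ∃ s t : ℤ, (w ^ (2 * m + 1)).im =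
        w.im * ((2 * m + 1) * w.re ^ (2 * m) + w.im ^ 2 * s) ∧
      (w ^ (2 * m + 1)).re = w.re ^ (2 * m) * w.re + w.im ^ 2 * t := by
  induction m with
  | zero => exact ⟨0, 0, by simp⟩
  | succ m ih =>
    obtain ⟨s, t, him, hre⟩ := ih
    set c := w.re ^ (2 * m) with hc
    have hc' : w.re ^ (2 * (m + 1)) = c * w.re ^ 2 := by rw [hc]; ring
    refine ⟨-((2 * m + 1) * c + w.im ^ 2 * s) + w.re ^ 2 * s + 2 * w.re * t,
      -(c * w.re) + w.re ^ 2 * t - w.im ^ 2 * t -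
        2 * w.re * ((2 * m + 1) * c + w.im ^ 2 * s), ?_, ?_⟩
    · rw [show 2 * (m + 1) + 1 = (2 * m + 1) + 2 by ring, pow_add, hc', Zsqrtd.im_mul, hre, him]
      simp only [pow_two w, Zsqrtd.re_mul, Zsqrtd.im_mul]
      push_cast
      ring
    · rw [show 2 * (m + 1) + 1 = (2 * m + 1) + 2 by ring, pow_add, hc', Zsqrtd.re_mul, hre, him]
      simp only [pow_two w, Zsqrtd.re_mul, Zsqrtd.im_mul]
      ring

/-- If an odd power of a Gaussian integer of odd norm has imaginary part `4`, then the base has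
imaginary part `±4`. -/
theorem GaussianInt.im_eq_of_pow_im_eq_four {w : GaussianInt} {m : ℕ}
    (hw : Odd (w.re ^ 2 + w.im ^ 2)) (h : (w ^ (2 * m + 1)).im = 4) :
    w.im = 4 ∨ w.im = -4 := by
  rcases Int.even_or_odd w.im with hv | hv
  · have hu : Odd w.re := by
      by_contra hu
      rw [Int.not_odd_iff_even] at hu
      exact (Int.not_even_iff_odd.2 hw) ((hu.pow_of_ne_zero two_ne_zero).add
        (hv.pow_of_ne_zero two_ne_zero))
    obtain ⟨s, t, him, -⟩ := GaussianInt.pow_odd_modEq_im w m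
    rw [h] at him
    set k : ℤ := (2 * m + 1) * w.re ^ (2 * m) + w.im ^ 2 * s
    have hk : Odd k := by
      refine Odd.add_even (Odd.mul ⟨m, rfl⟩ hu.pow) ?_
      exact (hv.pow_of_ne_zero two_ne_zero).mul_right s
    have hk4 : k ∣ 4 := ⟨w.im, by linarith⟩
    have hle : k ≤ 4 := Int.le_of_dvd (by norm_num) hk4
    have hge : -4 ≤ k := by
      have := Int.le_of_dvd (by norm_num) ((neg_dvd).2 hk4)
      linarith
    obtain ⟨j, hj⟩ := hk
    have : k = -3 ∨ k = -1 ∨ k = 1 ∨ k = 3 := by omega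
    rcases this with hk | hk | hk | hk <;> rw [hk] at him <;> omega
  · exfalso
    have hu : Even w.re := by
      by_contra hu
      rw [Int.not_even_iff_odd] at hu
      exact (Int.not_even_iff_odd.2 hw) ((hu.pow).add_odd hv.pow)
    obtain ⟨s, t, -, him⟩ := GaussianInt.pow_odd_modEq_re w m
    rw [h] at him
    have hodd : Odd ((-1) ^ m * w.im ^ (2 * m) * w.im + w.re ^ 2 * t) := by
      refine Odd.add_even ((Odd.mul ?_ hv.pow).mul hv) ?_
      · exact Odd.pow (by decide)
      · exact (hu.pow_of_ne_zero two_ne_zero).mul_right t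
    rw [← him] at hodd
    exact absurd hodd (by decide)

/-- The `2`-adic expansion of `(±1 ± 4i) ^ (2 ^ (k + 1))`. -/
theorem GaussianInt.pow_two_pow_modEq {w : GaussianInt} (hre : w.re = 1 ∨ w.re = -1)
    (him : w.im = 4 ∨ w.im = -4) (k : ℕ) :
    ∃ A B : ℤ, w ^ (2 ^ (k + 1)) = ⟨1 + 2 ^ (k + 4) * A, 2 ^ (k + 3) * (2 * B + 1)⟩ := by
  induction k with
  | zero =>
    rcases hre with hre | hre <;> rcases him with him | him
    · exact ⟨-1, 0, by ext <;> simp [pow_two, hre, him]⟩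
    · exact ⟨-1, -1, by ext <;> simp [pow_two, hre, him]⟩
    · exact ⟨-1, -1, by ext <;> simp [pow_two, hre, him]⟩
    · exact ⟨-1, 0, by ext <;> simp [pow_two, hre, him]⟩
  | succ k ih =>
    obtain ⟨A, B, h⟩ := ih
    refine ⟨A + 2 ^ (k + 3) * A ^ 2 - 2 ^ (k + 1) * (2 * B + 1) ^ 2,
      B + 2 ^ (k + 3) * A * (2 * B + 1), ?_⟩
    rw [pow_succ 2 (k + 1), pow_mul, h, pow_two]
    ext <;> simp <;> ring

/-- An odd power of a Gaussian integer congruent to `1 + 2 ^ (k + 3) i` modulo `2 ^ (k + 4)` is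
again congruent to it. -/
theorem GaussianInt.pow_odd_modEq_two_pow {z : GaussianInt} {k : ℕ}
    (hz : ∃ A B : ℤ, z = ⟨1 + 2 ^ (k + 4) * A, 2 ^ (k + 3) * (2 * B + 1)⟩) (m : ℕ) :
    ∃ A B : ℤ, z ^ (2 * m + 1) = ⟨1 + 2 ^ (k + 4) * A, 2 ^ (k + 3) * (2 * B + 1)⟩ := by
  induction m with
  | zero => simpa using hz
  | succ m ih =>
    obtain ⟨A, B, h⟩ := ih
    obtain ⟨C, D, rfl⟩ := hz
    rw [show 2 * (m + 1) + 1 = (2 * m + 1) + 2 by ring, pow_add, h, pow_two]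
    set P : ℤ := 2 ^ k with hP
    refine ⟨A + 2 * C - 4 * P * (2 * D + 1) ^ 2 + 16 * P * C ^ 2 +
        16 * P * A * (2 * C - 4 * P * (2 * D + 1) ^ 2 + 16 * P * C ^ 2)
        - 8 * P * (2 * B + 1) * (2 * D + 1) * (1 + 16 * P * C),
      B + 8 * P * (2 * B + 1) * (2 * C - 4 * P * (2 * D + 1) ^ 2 + 16 * P * C ^ 2) +
        (2 * D + 1) * (1 + 16 * P * C) * (1 + 16 * P * A), ?_⟩
    ext <;> simp [pow_add, ← hP] <;> ring

/-- No power of `±1 ± 4i` with exponent `n ≡ 1 (mod 4)`, `n > 1`, has imaginary part `4`. -/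
theorem GaussianInt.pow_im_ne_four {w : GaussianInt} (hre : w.re = 1 ∨ w.re = -1)
    (him : w.im = 4 ∨ w.im = -4) {r : ℕ} (hr : r ≠ 0) : (w ^ (4 * r + 1)).im ≠ 4 := by
  intro h
  obtain ⟨k, j, hj, hrk⟩ := Nat.exists_eq_two_pow_mul_odd hr
  obtain ⟨m, rfl⟩ := hj
  obtain ⟨A, B, hAB⟩ := GaussianInt.pow_odd_modEq_two_pow
    (GaussianInt.pow_two_pow_modEq hre him (k + 1)) m
  rw [← pow_mul, show 2 ^ (k + 1 + 1) * (2 * m + 1) = 4 * r by rw [hrk]; ring] at hAB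
  rw [pow_succ, hAB, Zsqrtd.im_mul] at h
  simp only [show k + 1 + 4 = k + 5 from rfl, show k + 1 + 3 = k + 4 from rfl, pow_add] at h
  have hP : (0 : ℤ) < 2 ^ k := by positivity
  generalize (2 : ℤ) ^ k = P at h hP
  have hdiff : ∃ E : ℤ, 4 - w.im = P * 16 * (2 * E + 1) := by
    rcases hre with hre | hre
    · exact ⟨A * w.im + B, by rw [← h, hre]; ring⟩
    · exact ⟨A * w.im - B - 1, by rw [← h, hre]; ring⟩
  obtain ⟨E, hE⟩ := hdiff
  rcases him with him | him <;> rw [him] at hE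
  · have : P * 16 ≠ 0 := by positivity
    have h3 : 2 * E + 1 = 0 := by
      rcases mul_eq_zero.1 (show P * 16 * (2 * E + 1) = 0 by linarith) with h | h
      · exact absurd h this
      · exact h
    omega
  · have : (8 : ℤ) = 16 * (P * (2 * E + 1)) := by linarith
    omega

/-- `x ^ 2 + 16` is not a power of `17` with exponent congruent to `3` modulo `4`. -/
theorem sq_add_sixteen_ne_seventeen_pow (x : ℤ) (r : ℕ) : x ^ 2 + 16 ≠ 17 ^ (4 * r + 3) := by
  intro h
  have h5 := congrArg (Int.cast : ℤ → ZMod 5) h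
  push_cast at h5
  rw [pow_add, pow_mul, show (17 : ZMod 5) ^ 4 = 1 from by decide, one_pow] at h5
  generalize (x : ZMod 5) = z at h5
  revert z
  decide

/-- For odd primes `p` and `n`, the number `(p ^ a) ^ 2 + 16` is not an `n`-th power. -/
theorem prime_pow_sq_add_sixteen_ne_pow {p a n : ℕ} {y : ℤ} (hp : p.Prime) (hpodd : Odd p)
    (hn : n.Prime) (hnodd : Odd n) : ((p : ℤ) ^ a) ^ 2 + 16 ≠ y ^ n := by
  intro h
  have hpZ : Odd (p : ℤ) := by exact_mod_cast hpodd
  obtain ⟨w, hw⟩ := GaussianInt.exists_pow_eq_of_sq_add_sixteen hpZ.pow hnodd h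
  have hnorm : (w.re ^ 2 + w.im ^ 2) ^ n = ((p : ℤ) ^ a) ^ 2 + 16 := by
    have h1 := map_pow Zsqrtd.normMonoidHom w n
    rw [hw] at h1
    have h2 : Zsqrtd.norm (⟨(p : ℤ) ^ a, 4⟩ : GaussianInt) = w.norm ^ n := h1
    rw [Zsqrtd.norm_def, Zsqrtd.norm_def] at h2
    rw [show w.re ^ 2 + w.im ^ 2 = w.re * w.re - -1 * w.im * w.im by ring, ← h2]
    ring
  obtain ⟨m, hm⟩ := hnodd
  have hwodd : Odd (w.re ^ 2 + w.im ^ 2) := by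
    rw [← Int.odd_pow' hn.ne_zero, hnorm]
    exact hpZ.pow.pow.add_even (by decide)
  have him4 : (w ^ (2 * m + 1)).im = 4 := by rw [← hm, hw]
  have him := GaussianInt.im_eq_of_pow_im_eq_four hwodd him4
  have hsq : w.im ^ 2 = 16 := by rcases him with h | h <;> rw [h] <;> norm_num
  rw [hsq] at hnorm
  obtain ⟨s, -, hre, -⟩ := GaussianInt.pow_odd_modEq_re w m
  rw [← hm, hw, pow_mul, hsq] at hre
  set K : ℤ := (2 * m + 1) * ((-1) ^ m * 16 ^ m) + w.re ^ 2 * s with hK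
  have habs : p ^ a = w.re.natAbs * K.natAbs := by
    rw [← Int.natAbs_mul, ← hre]
    simp [Int.natAbs_pow]
  obtain ⟨c, -, hc⟩ := (Nat.dvd_prime_pow hp).1 (Dvd.intro _ habs.symm)
  obtain ⟨d, -, hd⟩ := (Nat.dvd_prime_pow hp).1 (Dvd.intro_left _ habs.symm)
  have hn2 : 2 ≤ n := hn.two_le
  rcases Nat.eq_zero_or_pos c with hc0 | hc0
  · rw [hc0, pow_zero] at hc
    have hre1 : w.re = 1 ∨ w.re = -1 := Int.natAbs_eq_iff.1 hc
    rcases Nat.even_or_odd m with ⟨r, hr⟩ | ⟨r, hr⟩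
    · have hr0 : r ≠ 0 := by omega
      refine GaussianInt.pow_im_ne_four hre1 him hr0 ?_
      rw [← him4]
      congr 2
      omega
    · refine sq_add_sixteen_ne_seventeen_pow ((p : ℤ) ^ a) r ?_
      rw [← hnorm, show n = 4 * r + 3 by omega]
      congr 1
      rcases hre1 with h | h <;> rw [h] <;> norm_num
  · have hpu : (p : ℤ) ∣ w.re := by
      rw [Int.natCast_dvd, hc]
      exact dvd_pow_self p hc0.ne'
    rcases Nat.lt_or_ge d 2 with hd2 | hd2
    · have hKle : K.natAbs ≤ w.re.natAbs := by
        rw [hc, hd]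
        exact Nat.pow_le_pow_right hp.pos (by omega)
      have hle : ((p : ℤ) ^ a) ≤ w.re ^ 2 := by
        rw [← Int.natAbs_sq w.re]
        have : p ^ a ≤ w.re.natAbs ^ 2 := by
          rw [habs, pow_two]
          exact Nat.mul_le_mul_left _ hKle
        exact_mod_cast this
      have hpow : (w.re ^ 2 + 16) ^ 2 ≤ (w.re ^ 2 + 16) ^ n :=
        pow_le_pow_right₀ (by nlinarith [sq_nonneg w.re]) hn2
      have hpos : (0 : ℤ) ≤ (p : ℤ) ^ a := by positivity
      nlinarith [sq_nonneg w.re]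
    · have hpK : (p : ℤ) ^ 2 ∣ K := by
        rw [← Nat.cast_pow, Int.natCast_dvd, hd]
        exact pow_dvd_pow p hd2
      have hpn : (p : ℤ) ^ 2 ∣ (2 * m + 1) * ((-1) ^ m * 16 ^ m) := by
        rw [hK] at hpK
        exact (dvd_add_left (Dvd.dvd.mul_right (pow_dvd_pow_of_dvd hpu 2) s)).1 hpK
      have hpn' : p ^ 2 ∣ n * 16 ^ m := by
        have h1 := Int.natAbs_dvd_natAbs.2 hpn
        rw [show ((2 : ℤ) * m + 1) = (n : ℤ) by rw [hm]; push_cast; rfl] at h1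
        simpa [Int.natAbs_mul, Int.natAbs_pow] using h1
      have hcop : Nat.Coprime (p ^ 2) (16 ^ m) := by
        refine Nat.Coprime.pow _ _ ?_
        exact (Nat.coprime_two_right.2 hpodd).pow_right 4
      have hsqn := hcop.dvd_of_dvd_mul_right hpn'
      rw [pow_two] at hsqn
      exact hp.one_lt.ne' (Nat.isUnit_iff.1 (hn.prime.squarefree p hsqn))

theorem sq_add_sixteen_eq_sq {x z : ℕ} (hx : Odd x) (h : x ^ 2 + 16 = z ^ 2) :
    x = 3 ∧ z = 5 := by
  have hz : z ≤ 8 := by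
    by_contra! hz
    have : x < z := by nlinarith
    nlinarith
  have hxz : x < z := by nlinarith
  obtain ⟨j, rfl⟩ := hx
  have hj : j ≤ 3 := by omega
  interval_cases j <;> interval_cases z <;> simp_all

/-- If `p` is an odd prime, `q` is a prime, `a ≥ 1`, `b ≥ 2` and
`p^(2a) + 16 = q^b`, then `(p, a, q, b) = (3, 1, 5, 2)`. -/
theorem p_pow_two_a_add_sixteen (p q a b : ℕ)
    (hp : p.Prime) (hpodd : Odd p) (hq : q.Prime)
    (ha : 1 ≤ a) (hb : 2 ≤ b)
    (heq : p ^ (2 * a) + 16 = q ^ b) :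
    p = 3 ∧ a = 1 ∧ q = 5 ∧ b = 2 := by
  rcases Nat.even_or_odd b with ⟨c, hc⟩ | hbodd
  · obtain ⟨hx, hz⟩ := sq_add_sixteen_eq_sq (x := p ^ a) (z := q ^ c) hpodd.pow (by
      rw [← pow_mul, ← pow_mul, mul_comm a 2, heq, hc]
      congr 1
      omega)
    obtain ⟨hp3, ha1⟩ := (Nat.Prime.pow_eq_iff Nat.prime_three).1 hx
    obtain ⟨hq5, hc1⟩ := (Nat.Prime.pow_eq_iff Nat.prime_five).1 hz
    exact ⟨hp3, ha1, hq5, by omega⟩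
  · obtain ⟨k, hk⟩ := Nat.minFac_dvd b
    have hl : b.minFac.Prime := Nat.minFac_prime (by omega)
    have hlodd : Odd b.minFac := hbodd.of_dvd_nat (Nat.minFac_dvd b)
    refine absurd ?_ (prime_pow_sq_add_sixteen_ne_pow (a := a) (y := (q : ℤ) ^ k) hp hpodd hl hlodd)
    rw [← pow_mul, ← pow_mul, mul_comm k, ← hk, mul_comm a]
    exact_mod_cast heq
end
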